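/- arXiv:1703.09524 — 2 statements merged into one kernel-verified Lean document; each statement's English description precedes it below -/
import Mathlib

section
/- Fix ℓ ∈ ℕ. Let p, q ∈ ℕ be relatively prime with ℓ+2 < q < p, and let X = {(z,w) ∈ ℂ² : z^p = w^q}. Then there do not exist an open neighborhood U of the origin in ℂ² and a holomorphic map H : U → Mat(2×2,ℂ) such that H(0,0) is invertible and A(ζ)H(ζ) = H(ζ)B(ζ) for all ζ ∈ X ∩ U. In other words, the restrictions of A and B to X are not locally holomorphically similar at the origin. -/
open Metric Filter Topology

/-- Taylor coefficients at `0` of a function holomorphic on a closed disc, with Cauchy estimates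
and a remainder bound depending only on the radius and on a bound for the function. -/
theorem exists_taylor_coeff_bound {R M : ℝ} (hR : 0 < R) {g : ℂ → ℂ}
    (hg : DifferentiableOn ℂ g (closedBall 0 R)) (hM : ∀ z ∈ closedBall (0 : ℂ) R, ‖g z‖ ≤ M) :
    ∃ a : ℕ → ℂ, (∀ k, ‖a k‖ ≤ M / R ^ k) ∧ ∀ (N : ℕ) (z : ℂ), ‖z‖ ≤ R / 2 →
      ‖g z - ∑ k ∈ Finset.range N, a k * z ^ k‖ ≤ 2 * M * (‖z‖ / R) ^ N := by
  have hM0 : 0 ≤ M := (norm_nonneg _).trans (hM 0 (mem_closedBall_self hR.le))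
  have hd : DiffContOnCl ℂ g (ball 0 R) := by
    refine ⟨hg.mono ball_subset_closedBall, ?_⟩
    rw [closure_ball _ hR.ne']
    exact hg.continuousOn
  have ha : ∀ k : ℕ, ‖(k.factorial : ℂ)⁻¹ * iteratedDeriv k g 0‖ ≤ M / R ^ k := by
    intro k
    have h := Complex.norm_iteratedDeriv_le_of_forall_mem_sphere_norm_le k hR hd
      (fun z hz => hM z (sphere_subset_closedBall hz))
    have hk : (0 : ℝ) < k.factorial := by exact_mod_cast k.factorial_pos
    rw [norm_mul, norm_inv, Complex.norm_natCast]
    calc _ ≤ (k.factorial : ℝ)⁻¹ * (k.factorial * M / R ^ k) := by gcongr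
      _ = M / R ^ k := by field_simp
  refine ⟨_, ha, fun N z hz => ?_⟩
  have hs := Complex.hasSum_taylorSeries_on_ball (r := R.toNNReal) (c := 0) (f := g) (z := z)
    (by rw [Real.coe_toNNReal _ hR.le]; exact hg.mono ball_subset_closedBall)
    (by rw [Real.coe_toNNReal _ hR.le, mem_ball_zero_iff]; linarith)
  have hx : ‖z‖ / R ≤ 1 / 2 := by rw [div_le_iff₀ hR]; linarith
  have key := dist_le_of_le_geometric_of_tendsto (‖z‖ / R) M (by linarith)
    (f := fun N => ∑ k ∈ Finset.range N, ((k.factorial : ℂ)⁻¹ * iteratedDeriv k g 0) * z ^ k)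
    (a := g z) (fun n => by
      rw [Finset.sum_range_succ, dist_self_add_right, norm_mul, norm_pow, div_pow]
      calc _ ≤ M / R ^ n * ‖z‖ ^ n := by gcongr; exact ha n
        _ = _ := by ring) (by
      refine hs.tendsto_sum_nat.congr fun n => Finset.sum_congr rfl fun k _ => ?_
      simp only [sub_zero, smul_eq_mul]; ring) N
  rw [dist_comm, dist_eq_norm] at key
  refine key.trans ?_
  rw [div_le_iff₀ (by linarith)]
  nlinarith [mul_nonneg hM0 (pow_nonneg (div_nonneg (norm_nonneg z) hR.le) N)]

/-- A holomorphic function of two variables has polynomial approximations of every order at the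
origin. -/
theorem exists_polynomial_approx {U : Set (ℂ × ℂ)} (hU : IsOpen U) (h0 : (0, 0) ∈ U)
    {f : ℂ × ℂ → ℂ} (hf : DifferentiableOn ℂ f U) (N : ℕ) :
    ∃ (c : ℕ → ℕ → ℂ) (C r : ℝ), 0 < r ∧ ∀ z w : ℂ, ‖z‖ ≤ r → ‖w‖ ≤ r →
      ‖f (z, w) - ∑ k ∈ Finset.range N, ∑ m ∈ Finset.range N, c k m * z ^ k * w ^ m‖ ≤
        C * (‖z‖ ^ N + ‖w‖ ^ N) := by
  obtain ⟨R, hR, hRU⟩ := nhds_basis_closedBall.mem_iff.1 (hU.mem_nhds h0)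
  have hmem : ∀ z w : ℂ, ‖z‖ ≤ R → ‖w‖ ≤ R → (z, w) ∈ closedBall ((0, 0) : ℂ × ℂ) R := by
    intro z w hz hw
    rw [← closedBall_prod_same]
    exact ⟨mem_closedBall_zero_iff.2 hz, mem_closedBall_zero_iff.2 hw⟩
  obtain ⟨M, hM⟩ := (isCompact_closedBall ((0, 0) : ℂ × ℂ) R).exists_bound_of_continuousOn
    (hf.continuousOn.mono hRU)
  have hM0 : 0 ≤ M := (norm_nonneg _).trans (hM _ (mem_closedBall_self hR.le))
  have hz : ∀ w : ℂ, ∃ a : ℕ → ℂ, ‖w‖ ≤ R → (∀ k, ‖a k‖ ≤ M / R ^ k) ∧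
      ∀ (N : ℕ) (z : ℂ), ‖z‖ ≤ R / 2 →
      ‖f (z, w) - ∑ k ∈ Finset.range N, a k * z ^ k‖ ≤ 2 * M * (‖z‖ / R) ^ N := by
    intro w
    by_cases hw : ‖w‖ ≤ R
    · obtain ⟨a, ha⟩ := exists_taylor_coeff_bound hR (g := fun z => f (z, w)) (M := M)
        (hf.comp (by fun_prop)
          fun z hz => hRU (hmem z w (mem_closedBall_zero_iff.1 hz) hw))
        (fun z hz => hM _ (hmem z w (mem_closedBall_zero_iff.1 hz) hw))
      exact ⟨a, fun _ => ha⟩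
    · exact ⟨0, fun h => absurd h hw⟩
  choose a ha using hz
  have hdiff : ∀ k, DifferentiableOn ℂ (fun w => a w k) (ball 0 R) := by
    intro k
    induction k using Nat.strong_induction_on with
    | _ k ih =>
      have hlim : TendstoUniformlyOn
          (fun z w => (f (z, w) - ∑ j ∈ Finset.range k, a w j * z ^ j) / z ^ k)
          (fun w => a w k) (𝓝[≠] (0 : ℂ)) (ball 0 R) := by
        rw [Metric.tendstoUniformlyOn_iff]
        intro ε hε
        have hc : Tendsto (fun z : ℂ => 2 * M / R ^ (k + 1) * ‖z‖) (𝓝[≠] 0) (𝓝 0) := by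
          have : Continuous fun z : ℂ => 2 * M / R ^ (k + 1) * ‖z‖ := by fun_prop
          simpa using (this.tendsto 0).mono_left nhdsWithin_le_nhds
        filter_upwards [hc.eventually_lt_const hε, self_mem_nhdsWithin,
          nhdsWithin_le_nhds (closedBall_mem_nhds (0 : ℂ) (half_pos hR))] with z hzε hz0 hzR w hw
        have hzpos : 0 < ‖z‖ ^ k := pow_pos (norm_pos_iff.2 hz0) k
        have h := (ha w (mem_ball_zero_iff.1 hw).le).2 (k + 1) z (mem_closedBall_zero_iff.1 hzR)
        rw [Finset.sum_range_succ, ← sub_sub] at h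
        refine lt_of_le_of_lt ?_ hzε
        have hzk : z ^ k ≠ 0 := pow_ne_zero _ hz0
        rw [dist_comm, dist_eq_norm, div_sub' hzk, norm_div, norm_pow, div_le_iff₀ hzpos,
          mul_comm (z ^ k)]
        refine h.trans_eq ?_
        rw [div_pow]; ring
      refine hlim.tendstoLocallyUniformlyOn.differentiableOn ?_ isOpen_ball
      filter_upwards [nhdsWithin_le_nhds (closedBall_mem_nhds (0 : ℂ) hR)] with z hz
      refine DifferentiableOn.div_const (DifferentiableOn.sub ?_ ?_) _
      · exact hf.comp (by fun_prop)
          fun w hw => hRU (hmem z w (mem_closedBall_zero_iff.1 hz) (mem_ball_zero_iff.1 hw).le)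
      · exact DifferentiableOn.fun_sum fun j hj =>
          (ih j (Finset.mem_range.1 hj)).mul_const _
  have hw : ∀ k, ∃ b : ℕ → ℂ, ∀ w : ℂ, ‖w‖ ≤ R / 2 / 2 →
      ‖a w k - ∑ m ∈ Finset.range N, b m * w ^ m‖ ≤
        2 * (M / R ^ k) * (‖w‖ / (R / 2)) ^ N := by
    intro k
    obtain ⟨b, -, hb⟩ := exists_taylor_coeff_bound (half_pos hR) (g := fun w => a w k)
      (M := M / R ^ k) ((hdiff k).mono (closedBall_subset_ball (by linarith)))
      (fun w hw => (ha w (by rw [mem_closedBall_zero_iff] at hw; linarith)).1 k)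
    exact ⟨b, hb N⟩
  choose b hb using hw
  refine ⟨b, 2 * M / R ^ N + ∑ k ∈ Finset.range N, 2 * (M / R ^ k) / (R / 2) ^ N * R ^ k,
    R / 2 / 2, by positivity,
    fun z w hz hw => ?_⟩
  set S := ∑ k ∈ Finset.range N, 2 * (M / R ^ k) / (R / 2) ^ N * R ^ k
  have hS : 0 ≤ S := by positivity
  have h1 := (ha w (by linarith)).2 N z (by linarith)
  have h2 : ‖∑ k ∈ Finset.range N, a w k * z ^ k -
      ∑ k ∈ Finset.range N, ∑ m ∈ Finset.range N, b k m * z ^ k * w ^ m‖ ≤ S * ‖w‖ ^ N := by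
    rw [← Finset.sum_sub_distrib, Finset.sum_mul]
    refine norm_sum_le_of_le _ fun k _ => ?_
    have : a w k * z ^ k - ∑ m ∈ Finset.range N, b k m * z ^ k * w ^ m =
        (a w k - ∑ m ∈ Finset.range N, b k m * w ^ m) * z ^ k := by
      rw [sub_mul, Finset.sum_mul]
      congr 1
      exact Finset.sum_congr rfl fun m _ => by ring
    rw [this, norm_mul, norm_pow]
    calc _ ≤ 2 * (M / R ^ k) * (‖w‖ / (R / 2)) ^ N * R ^ k := by
          gcongr
          · exact hb k w hw
          · linarith
      _ = _ := by rw [div_pow]; ring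
  calc _ ≤ _ := norm_sub_le_norm_sub_add_norm_sub _ (∑ k ∈ Finset.range N, a w k * z ^ k) _
    _ ≤ 2 * M * (‖z‖ / R) ^ N + S * ‖w‖ ^ N := add_le_add h1 h2
    _ = 2 * M / R ^ N * ‖z‖ ^ N + S * ‖w‖ ^ N := by rw [div_pow]; ring
    _ ≤ _ := by
      have : 0 ≤ 2 * M / R ^ N * ‖w‖ ^ N + S * ‖z‖ ^ N := by positivity
      linarith

/-- The pullback of a holomorphic function along `t ↦ (t ^ q, t ^ p)` agrees to any order with a
polynomial whose exponents lie in the numerical semigroup generated by `q` and `p`. -/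
theorem exists_polynomial_approx_cusp {U : Set (ℂ × ℂ)} (hU : IsOpen U) (h0 : (0, 0) ∈ U)
    {f : ℂ × ℂ → ℂ} (hf : DifferentiableOn ℂ f U) {p q N : ℕ} (hp : p ≠ 0) (hq : q ≠ 0)
    (hN : N ≠ 0) :
    ∃ P : Polynomial ℂ, (∀ n, P.coeff n ≠ 0 → ∃ k m, n = q * k + p * m) ∧
      P.coeff 0 = f (0, 0) ∧
      (fun t : ℂ => f (t ^ q, t ^ p) - P.eval t) =O[𝓝 0] fun t => t ^ N := by
  obtain ⟨c, C, r, hr, hc⟩ := exists_polynomial_approx hU h0 hf N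
  have hO : (fun t : ℂ => f (t ^ q, t ^ p) -
      (∑ k ∈ Finset.range N, ∑ m ∈ Finset.range N,
        Polynomial.C (c k m) * Polynomial.X ^ (q * k + p * m)).eval t) =O[𝓝 0]
      fun t => t ^ N := by
    refine Asymptotics.IsBigO.of_bound (|C| * 2) ?_
    have hs : ∀ {s : ℕ}, s ≠ 0 → ∀ {t : ℂ}, ‖t‖ ≤ 1 → ‖t ^ s‖ ≤ ‖t‖ := fun hs t ht => by
      rw [norm_pow]; exact pow_le_of_le_one (norm_nonneg t) ht hs
    filter_upwards [closedBall_mem_nhds (0 : ℂ) hr, closedBall_mem_nhds (0 : ℂ) one_pos]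
      with t htr ht1
    rw [mem_closedBall_zero_iff] at htr ht1
    have h := hc (t ^ q) (t ^ p) ((hs hq ht1).trans htr) ((hs hp ht1).trans htr)
    have he : (∑ k ∈ Finset.range N, ∑ m ∈ Finset.range N,
        Polynomial.C (c k m) * Polynomial.X ^ (q * k + p * m)).eval t =
        ∑ k ∈ Finset.range N, ∑ m ∈ Finset.range N, c k m * (t ^ q) ^ k * (t ^ p) ^ m := by
      simp only [Polynomial.eval_finsetSum, Polynomial.eval_mul, Polynomial.eval_C,
        Polynomial.eval_pow, Polynomial.eval_X, pow_add, pow_mul, mul_assoc]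
    rw [he]
    calc _ ≤ _ := h
      _ ≤ |C| * (‖t‖ ^ N + ‖t‖ ^ N) := by
        gcongr
        · exact le_abs_self C
        · exact hs hq ht1
        · exact hs hp ht1
      _ = _ := by rw [norm_pow]; ring
  refine ⟨_, fun n hn => ?_, ?_, hO⟩
  · contrapose! hn
    simp only [Polynomial.finsetSum_coeff, Polynomial.coeff_C_mul, Polynomial.coeff_X_pow]
    exact Finset.sum_eq_zero fun k _ => Finset.sum_eq_zero fun m _ => by simp [hn k m]
  · have h := Asymptotics.IsBigO.eq_zero_of_norm_pow (x₀ := (0 : ℂ)) (n := N)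
      (by simpa using hO.norm_right) hN
    rw [zero_pow hq, zero_pow hp, sub_eq_zero, ← Polynomial.coeff_zero_eq_eval_zero] at h
    exact h.symm

/-- A polynomial that is `O(t ^ N)` at the origin is divisible by `X ^ N`. -/
theorem Polynomial.X_pow_dvd_of_isBigO {P : Polynomial ℂ} {N : ℕ}
    (h : (fun t : ℂ => P.eval t) =O[𝓝 0] fun t => t ^ N) : Polynomial.X ^ N ∣ P := by
  have key : ∀ k ≤ N, Polynomial.X ^ k ∣ P := by
    intro k
    induction k with
    | zero => simp
    | succ k ih =>
      intro hk
      obtain ⟨Q, rfl⟩ := ih (by omega)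
      rw [pow_succ]
      refine mul_dvd_mul_left _ ?_
      rw [Polynomial.X_dvd_iff, Polynomial.coeff_zero_eq_eval_zero]
      have hQ : (fun t : ℂ => Q.eval t) =O[𝓝[≠] 0] fun t => t ^ (N - k) := by
        have := (h.mono nhdsWithin_le_nhds).mul
          (Asymptotics.isBigO_refl (fun t : ℂ => (t ^ k)⁻¹) (𝓝[≠] (0 : ℂ)))
        refine this.congr' ?_ ?_
        · filter_upwards [self_mem_nhdsWithin] with t ht
          have : t ^ k ≠ 0 := pow_ne_zero _ ht
          simp only [Polynomial.eval_mul, Polynomial.eval_pow, Polynomial.eval_X]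
          field_simp
        · filter_upwards [self_mem_nhdsWithin] with t ht
          rw [pow_sub₀ _ ht (by omega)]
      have hlim : Tendsto (fun t : ℂ => t ^ (N - k)) (𝓝[≠] 0) (𝓝 0) := by
        have := ((continuous_pow (M := ℂ) (N - k)).tendsto 0).mono_left
          (nhdsWithin_le_nhds (s := {0}ᶜ))
        rwa [zero_pow (by omega)] at this
      exact tendsto_nhds_unique ((Q.continuous.tendsto 0).mono_left nhdsWithin_le_nhds)
        (hQ.trans_tendsto hlim)
  exact key N le_rfl

/-- For coprime `p`, `q` and `L < q`, the number `L * p - q` is not in the numerical semigroup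
generated by `q` and `p`. -/
theorem Nat.Coprime.mul_ne_mul_succ_add {p q L : ℕ} (hpq : Nat.Coprime p q) (hL : L < q)
    (k m : ℕ) : L * p ≠ q * (k + 1) + p * m := by
  intro h
  have hm : m < L := by
    by_contra! hm
    have : L * p ≤ m * p := Nat.mul_le_mul_right p hm
    nlinarith
  have hd : q ∣ p * (L - m) := ⟨k + 1, by
    obtain ⟨d, rfl⟩ := Nat.exists_eq_add_of_le hm.le
    rw [Nat.add_sub_cancel_left]
    linarith⟩
  have := Nat.le_of_dvd (by omega) (hpq.symm.dvd_of_dvd_mul_left hd)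
  omega


/-- `A(z,w) = [[z^{2+ℓ}·w^{2+ℓ}, z^{3+ℓ}],[w^{3+ℓ}, 0]]`. -/
noncomputable def matA (ℓ : ℕ) (p : ℂ × ℂ) : Matrix (Fin 2) (Fin 2) ℂ :=
  !![p.1 ^ (2 + ℓ) * p.2 ^ (2 + ℓ), p.1 ^ (3 + ℓ); p.2 ^ (3 + ℓ), 0]

/-- `B(z,w) = [[0, z^{3+ℓ}],[w^{3+ℓ}, z^{2+ℓ}·w^{2+ℓ}]]`. -/
noncomputable def matB (ℓ : ℕ) (p : ℂ × ℂ) : Matrix (Fin 2) (Fin 2) ℂ :=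
  !![0, p.1 ^ (3 + ℓ); p.2 ^ (3 + ℓ), p.1 ^ (2 + ℓ) * p.2 ^ (2 + ℓ)]

/-- On the curve `X = {z^p = w^q}` with `gcd(p,q) = 1` and `ℓ+2 < q < p`, the restrictions
of `A` and `B` to `X` are not locally holomorphically similar at the origin: no holomorphic
`H` near the origin has `H(0,0)` invertible and `AH = HB` on `X ∩ U`. -/
theorem not_locally_similar_on_cusp_curve (ℓ p q : ℕ) (hpq : Nat.Coprime p q)
    (hq : ℓ + 2 < q) (hp : q < p) :
    ¬ ∃ (U : Set (ℂ × ℂ)) (H : ℂ × ℂ → Matrix (Fin 2) (Fin 2) ℂ),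
      IsOpen U ∧ (0, 0) ∈ U ∧
      (∀ i j, DifferentiableOn ℂ (fun ζ => H ζ i j) U) ∧
      IsUnit (H (0, 0)) ∧
      (∀ ζ ∈ U, ζ.1 ^ p = ζ.2 ^ q → matA ℓ ζ * H ζ = H ζ * matB ℓ ζ) := by
  rintro ⟨U, H, hU, h0, hH, hunit, heq⟩
  have hp0 : p ≠ 0 := by omega
  have hq0 : q ≠ 0 := by omega
  set n := (2 + ℓ) * (p + q) with hn
  obtain ⟨Pa, -, ha0, ha⟩ := exists_polynomial_approx_cusp hU h0 (hH 0 0) hp0 hq0 n.succ_ne_zero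
  obtain ⟨Pb, hbS, -, hb⟩ := exists_polynomial_approx_cusp hU h0 (hH 0 1) hp0 hq0 n.succ_ne_zero
  obtain ⟨Pc, hcS, hc0, hc⟩ := exists_polynomial_approx_cusp hU h0 (hH 1 0) hp0 hq0 n.succ_ne_zero
  have hmul : ∀ (s : ℕ) {g : ℂ → ℂ}, g =O[𝓝 0] (fun t => t ^ (n + 1)) →
      (fun t => t ^ s * g t) =O[𝓝 0] fun t => t ^ (n + 1) := by
    intro s g hg
    have hs : (fun t : ℂ => t ^ s) =O[𝓝 0] fun _ => (1 : ℂ) :=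
      ((continuous_pow s).tendsto (0 : ℂ)).isBigO_one ℂ
    simpa using hs.mul hg
  have hcurve : ∀ᶠ t : ℂ in 𝓝 0, (t ^ q, t ^ p) ∈ U := by
    have hcont : Continuous fun t : ℂ => (t ^ q, t ^ p) := by fun_prop
    exact hcont.tendsto 0 (by simpa [hp0, hq0] using hU.mem_nhds h0)
  set P : Polynomial ℂ := Polynomial.X ^ n * Pa + Polynomial.X ^ ((3 + ℓ) * q) * Pc -
    Polynomial.X ^ ((3 + ℓ) * p) * Pb with hP
  have hPO : (fun t : ℂ => P.eval t) =O[𝓝 0] fun t => t ^ (n + 1) := by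
    refine ((((hmul n ha).add (hmul ((3 + ℓ) * q) hc)).sub
      (hmul ((3 + ℓ) * p) hb)).neg_left).congr' ?_ EventuallyEq.rfl
    filter_upwards [hcurve] with t ht
    have h := congrFun₂ (heq _ ht (by rw [← pow_mul, ← pow_mul, mul_comm])) 0 0
    simp only [matA, matB, Matrix.mul_apply, Fin.sum_univ_two, Matrix.of_apply,
      Matrix.cons_val', Matrix.cons_val_zero, Matrix.cons_val_one, Matrix.cons_val_fin_one] at h
    simp only [hP, hn, Polynomial.eval_add, Polynomial.eval_sub, Polynomial.eval_mul,
      Polynomial.eval_pow, Polynomial.eval_X]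
    linear_combination -h
  have hcoeff := Polynomial.X_pow_dvd_iff.1 (Polynomial.X_pow_dvd_of_isBigO hPO)
  have hlt : (3 + ℓ) * q < n := by rw [hn]; nlinarith
  have hltp : (3 + ℓ) * q < (3 + ℓ) * p := by nlinarith
  have hc00 : H (0, 0) 1 0 = 0 := by
    have h := hcoeff ((3 + ℓ) * q) (by omega)
    rw [hP, Polynomial.coeff_sub, Polynomial.coeff_add, Polynomial.coeff_X_pow_mul',
      Polynomial.coeff_X_pow_mul', Polynomial.coeff_X_pow_mul', if_neg (by omega),
      if_pos le_rfl, if_neg (by omega), Nat.sub_self, hc0] at h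
    simpa using h
  have ha00 : H (0, 0) 0 0 = 0 := by
    have h := hcoeff n (by omega)
    have hcn : Pc.coeff (n - (3 + ℓ) * q) = 0 := by
      by_contra hne
      obtain ⟨k, m, hkm⟩ := hcS _ hne
      refine hpq.mul_ne_mul_succ_add (L := 2 + ℓ) (by omega) k m ?_
      have : n = (3 + ℓ) * q + (q * k + p * m) := by omega
      rw [hn] at this
      linarith
    have hbn : (3 + ℓ) * p ≤ n → Pb.coeff (n - (3 + ℓ) * p) = 0 := by
      intro hle
      by_contra hne
      obtain ⟨k, m, hkm⟩ := hbS _ hne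
      refine hpq.symm.mul_ne_mul_succ_add (L := 2 + ℓ) (by omega) m k ?_
      have : n = (3 + ℓ) * p + (q * k + p * m) := by omega
      rw [hn] at this
      linarith
    rw [hP, Polynomial.coeff_sub, Polynomial.coeff_add, Polynomial.coeff_X_pow_mul',
      Polynomial.coeff_X_pow_mul', Polynomial.coeff_X_pow_mul', if_pos le_rfl,
      if_pos hlt.le, Nat.sub_self, ha0, hcn, ite_eq_right_iff.2 hbn] at h
    simpa using h
  rw [Matrix.isUnit_iff_isUnit_det, Matrix.det_fin_two, ha00, hc00] at hunit
  simp at hunit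
end

section
/- For every ℓ ∈ ℕ there exist a nonempty connected open set X ⊆ ℂ³ × ℂ² and holomorphic maps Φ, Ψ : X → Mat(4×4,ℂ) such that: (a) Φ and Ψ are locally holomorphically similar at every point of X, i.e. each ξ ∈ X has an open neighborhood U and a holomorphic H : U → Mat(4×4,ℂ) with H(ζ) invertible and Ψ(ζ) = H(ζ)⁻¹Φ(ζ)H(ζ) for all ζ ∈ U; (b) Φ and Ψ are globally C^ℓ similar on X, i.e. there is a map T : X → Mat(4×4,ℂ), C^ℓ in the real sense, with T(ζ) invertible and Ψ(ζ) = T(ζ)⁻¹Φ(ζ)T(ζ) for all ζ ∈ X; but (c) Φ and Ψ are not globally C^∞ similar on X: there is no map T : X → Mat(4×4,ℂ), C^∞ in the real sense, with T(ζ) invertible and Ψ(ζ) = T(ζ)⁻¹Φ(ζ)T(ζ) for all ζ ∈ X. -/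
namespace SimilarityCounterexample

open Set Filter Topology
open scoped ContDiff

/-- A function with constant exponential on a preconnected space is constant. -/
theorem eq_of_exp_eq_const {A : Type*} [TopologicalSpace A] [PreconnectedSpace A] {f : A → ℂ}
    (hf : Continuous f) (h : ∀ a b, Complex.exp (f a) = Complex.exp (f b)) (a b : A) :
    f a = f b := by
  refine Complex.isCoveringMap_exp.const_of_comp hf (fun a a' => ?_) a b
  exact Subtype.ext (h a a')

/-- A homotopy of loops in `ℂ \ {0}` cannot join a constant loop to a loop of winding
number `-1`. -/
theorem not_homotopy_const_winding (u : ℝ × ℝ → ℂ) (hu : Continuous u) (h0 : ∀ x, u x ≠ 0)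
    (hper : ∀ θ, u (θ, 2 * Real.pi) = u (θ, 0)) (hconst : ∀ φ, u (0, φ) = u (0, 0))
    (hwind : ∀ φ : ℝ, u (Real.pi, φ) = u (Real.pi, 0) * Complex.exp (-(φ * Complex.I))) :
    False := by
  obtain ⟨L, ⟨-, hexp⟩, -⟩ := Complex.isCoveringMapOn_exp.existsUnique_continuousMap_lifts
    (⟨u, hu⟩ : C(ℝ × ℝ, ℂ)) (Complex.exp_log (h0 (0, 0))) (fun a => h0 a)
  have hE : ∀ x, Complex.exp (L x) = u x := fun x => congrFun hexp x
  have e1 := eq_of_exp_eq_const (f := fun θ : ℝ => L (θ, 2 * Real.pi) - L (θ, 0))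
    (by fun_prop) (fun a b => by
      simp only [Complex.exp_sub, hE, hper, div_self (h0 _)]) 0 Real.pi
  have e2 := eq_of_exp_eq_const (f := fun φ : ℝ => L (0, φ))
    (by fun_prop) (fun a b => by
      simp only [hE]; rw [hconst a, hconst b]) (2 * Real.pi) 0
  have e3 := eq_of_exp_eq_const (f := fun φ : ℝ => L (Real.pi, φ) + φ * Complex.I)
    (by fun_prop) (fun a b => by
      simp only [Complex.exp_add, hE]
      rw [hwind a, hwind b, mul_assoc, mul_assoc, ← Complex.exp_add, ← Complex.exp_add]
      simp) (2 * Real.pi) 0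
  simp only [e2, sub_self] at e1
  have e4 : L (Real.pi, 2 * Real.pi) = L (Real.pi, 0) := (sub_eq_zero.1 e1.symm)
  simp [e4, Real.pi_ne_zero] at e3

/-- A function which is smooth off the origin and positively homogeneous of degree at least
`n + 1` is of class `C^n`. -/
theorem contDiff_of_homogeneous {E : Type} [NormedAddCommGroup E] [NormedSpace ℝ E]
    [FiniteDimensional ℝ E] (n : ℕ) : ∀ {F : Type} [NormedAddCommGroup F] [NormedSpace ℝ F]
    (k : ℕ) (_ : n + 1 ≤ k) (f : E → F) (_ : ContDiffOn ℝ ∞ f {0}ᶜ)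
    (_ : ∀ t : ℝ, 0 < t → ∀ x, f (t • x) = t ^ k • f x), ContDiff ℝ n f := by
  have bound : ∀ {F : Type} [NormedAddCommGroup F] [NormedSpace ℝ F]
      (k : ℕ) (_ : 1 ≤ k) (f : E → F) (_ : ContDiffOn ℝ ∞ f {0}ᶜ)
      (_ : ∀ t : ℝ, 0 < t → ∀ x, f (t • x) = t ^ k • f x),
      f 0 = 0 ∧ ∃ C, ∀ x, ‖f x‖ ≤ C * ‖x‖ ^ k := by
    intro F _ _ k hk f hf hom
    have hzero : f 0 = 0 := by
      have h2 := hom 2 two_pos 0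
      rw [smul_zero] at h2
      have h3 : ((2 : ℝ) ^ k - 1) • f 0 = 0 := by rw [sub_smul, one_smul, ← h2, sub_self]
      refine (smul_eq_zero.1 h3).resolve_left ?_
      have := one_lt_pow₀ (one_lt_two (α := ℝ)) (by omega : k ≠ 0)
      linarith
    have hc : ContinuousOn f (Metric.sphere 0 1) := hf.continuousOn.mono (fun x hx h0 => by
      simp [mem_singleton_iff.1 h0] at hx)
    obtain ⟨C, hC⟩ := (isCompact_sphere (0 : E) 1).exists_bound_of_continuousOn hc
    refine ⟨hzero, C, fun x => ?_⟩
    by_cases hx : x = 0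
    · subst hx; simp [hzero, zero_pow (by omega : k ≠ 0)]
    · have hn : 0 < ‖x‖ := norm_pos_iff.2 hx
      have h1 := hom ‖x‖ hn (‖x‖⁻¹ • x)
      rw [smul_smul, mul_inv_cancel₀ hn.ne', one_smul] at h1
      rw [h1, norm_smul, norm_pow, norm_norm, mul_comm]
      gcongr
      exact hC _ (by simp [norm_smul, hn.ne'])
  induction n with
  | zero =>
    intro F _ _ k hk f hf hom
    obtain ⟨hzero, C, hC⟩ := bound k (by omega) f hf hom
    rw [Nat.cast_zero, contDiff_zero, continuous_iff_continuousAt]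
    intro x
    by_cases hx : x = 0
    · subst hx
      rw [ContinuousAt, hzero]
      refine squeeze_zero_norm hC ?_
      have : Continuous fun x : E => C * ‖x‖ ^ k := by fun_prop
      simpa [zero_pow (by omega : k ≠ 0)] using this.tendsto 0
    · exact hf.continuousOn.continuousAt (isOpen_compl_singleton.mem_nhds hx)
  | succ n ih =>
    intro F _ _ k hk f hf hom
    obtain ⟨hzero, C, hC⟩ := bound k (by omega) f hf hom
    have hdiff : Differentiable ℝ f := by
      intro x
      by_cases hx : x = 0
      · subst hx
        refine HasFDerivAt.differentiableAt (f' := (0 : E →L[ℝ] F)) ?_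
        refine HasFDerivAt.of_isLittleO ?_
        have : (fun x : E => f x) =O[𝓝 0] fun x => ‖x‖ ^ k :=
          Asymptotics.IsBigO.of_bound C (Eventually.of_forall fun x => by simpa using hC x)
        simp only [hzero, sub_zero, zero_apply]
        exact this.trans_isLittleO (by
          simpa using Asymptotics.isLittleO_norm_pow_id (E' := E) (n := k) (by omega))
      · exact (hf.contDiffAt (isOpen_compl_singleton.mem_nhds hx)).differentiableAt (by simp)
    push_cast
    rw [contDiff_succ_iff_fderiv]
    refine ⟨hdiff, by simp, ih (k - 1) (by omega) _ ?_ ?_⟩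
    · exact hf.fderiv_of_isOpen isOpen_compl_singleton (by simp)
    · intro t ht x
      have h1 : HasFDerivAt (fun x => f (t • x)) ((fderiv ℝ f (t • x)).comp
          (t • ContinuousLinearMap.id ℝ E)) x :=
        (hdiff _).hasFDerivAt.comp x ((hasFDerivAt_id x).const_smul t)
      have h2 : HasFDerivAt (fun x => f (t • x)) (t ^ k • fderiv ℝ f x) x := by
        simp only [hom t ht]
        exact (hdiff x).hasFDerivAt.const_smul _
      have h3 := h1.unique h2
      obtain ⟨j, rfl⟩ : ∃ j, k = j + 1 := ⟨k - 1, by omega⟩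
      rw [ContinuousLinearMap.comp_smul, ContinuousLinearMap.comp_id, pow_succ', mul_smul] at h3
      exact smul_right_injective _ ht.ne' h3

/-- A smooth function vanishing on a punctured axis vanishes at the origin. -/
theorem eq_zero_of_axis {U : Set (ℝ × ℝ)} (hU : IsOpen U) (h0 : (0, 0) ∈ U) {g : ℝ × ℝ → ℂ}
    (hg : ContinuousOn g U) (h : ∀ p ∈ U, p.1 = 0 → p.2 ≠ 0 → g p = 0) : g (0, 0) = 0 := by
  have hc : ContinuousAt (fun t : ℝ => g (0, t)) 0 :=
    ContinuousAt.comp (f := fun t : ℝ => ((0 : ℝ), t)) (g := g)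
      (hg.continuousAt (hU.mem_nhds h0)) (by fun_prop)
  have hU' : ∀ᶠ t : ℝ in 𝓝 0, ((0 : ℝ), t) ∈ U :=
    (by fun_prop : ContinuousAt (fun t : ℝ => ((0 : ℝ), t)) 0).eventually (hU.mem_nhds h0)
  have h1 : Tendsto (fun t : ℝ => g (0, t)) (𝓝[≠] 0) (𝓝 (g (0, 0))) :=
    hc.tendsto.mono_left nhdsWithin_le_nhds
  have h2 : (fun t : ℝ => g (0, t)) =ᶠ[𝓝[≠] 0] fun _ => 0 := by
    filter_upwards [hU'.filter_mono nhdsWithin_le_nhds, self_mem_nhdsWithin] with t ht ht0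
    exact h _ ht rfl ht0
  exact tendsto_nhds_unique h1 (tendsto_const_nhds.congr' h2.symm)

/-- The coefficient of `s ^ k * t ^ n` in a relation
`s ^ (k + 1) * c = s ^ k * t ^ n * e + t ^ (n + 1) * f` between smooth functions vanishes at the
origin. -/
theorem smooth_obstruction (n : ℕ) {U : Set (ℝ × ℝ)} (hU : IsOpen U) (h0 : (0, 0) ∈ U) (k : ℕ) :
    ∀ (c e f : ℝ × ℝ → ℂ) (_ : ContDiffOn ℝ ∞ c U) (_ : ContDiffOn ℝ ∞ e U)
      (_ : ContDiffOn ℝ ∞ f U)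
      (_ : ∀ p ∈ U, (p.1 : ℂ) ^ (k + 1) * c p =
        (p.1 : ℂ) ^ k * (p.2 : ℂ) ^ n * e p + (p.2 : ℂ) ^ (n + 1) * f p), e (0, 0) = 0 := by
  induction k with
  | zero =>
    intro c e f hc he hf h
    have := eq_zero_of_axis hU h0 (g := fun p => e p + p.2 * f p) (by
      have : ContDiff ℝ ∞ fun p : ℝ × ℝ => (p.2 : ℂ) := Complex.ofRealCLM.contDiff.comp contDiff_snd
      exact (he.add (this.contDiffOn.mul hf)).continuousOn) (fun p hp h1 h2 => by
        have := h p hp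
        have h2' : (p.2 : ℂ) ^ n ≠ 0 := by simp [h2]
        simp only [h1, Complex.ofReal_zero, zero_add, pow_one, zero_mul, pow_zero, one_mul] at this
        apply mul_left_cancel₀ h2'
        rw [mul_zero]
        linear_combination -this)
    simpa using this
  | succ k ih =>
    intro c e f hc he hf h
    have hfst : ContDiff ℝ ∞ fun p : ℝ × ℝ => (p.1 : ℂ) :=
      Complex.ofRealCLM.contDiff.comp contDiff_fst
    have hder : ∀ {g : ℝ × ℝ → ℂ}, ContDiffOn ℝ ∞ g U →
        ContDiffOn ℝ ∞ (fun p => fderiv ℝ g p (1, 0)) U := fun hg =>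
      (hg.fderiv_of_isOpen hU (by simp)).clm_apply contDiffOn_const
    have hline : ∀ {g : ℝ × ℝ → ℂ}, ContDiffOn ℝ ∞ g U → ∀ p ∈ U,
        HasDerivAt (fun s : ℝ => g (s, p.2)) (fderiv ℝ g p (1, 0)) p.1 := by
      intro g hg p hp
      have h1 : HasFDerivAt g (fderiv ℝ g p) (p.1, p.2) :=
        ((hg.contDiffAt (hU.mem_nhds hp)).differentiableAt (by simp)).hasFDerivAt
      exact h1.comp_hasDerivAt p.1 ((hasDerivAt_id p.1).prodMk (hasDerivAt_const p.1 p.2))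
    have := ih (fun p => (k + 2 : ℂ) * c p + p.1 * fderiv ℝ c p (1, 0))
      (fun p => (k + 1 : ℂ) * e p + p.1 * fderiv ℝ e p (1, 0)) (fun p => fderiv ℝ f p (1, 0))
      ((contDiffOn_const.mul hc).add (hfst.contDiffOn.mul (hder hc)))
      ((contDiffOn_const.mul he).add (hfst.contDiffOn.mul (hder he))) (hder hf)
      (fun p hp => by
        have hid : HasDerivAt (fun s : ℝ => (s : ℂ)) 1 p.1 := Complex.ofRealCLM.hasDerivAt
        have hL := (hid.pow (k + 1 + 1)).mul (hline hc p hp)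
        have hR := (((hid.pow (k + 1)).mul_const ((p.2 : ℂ) ^ n)).mul (hline he p hp)).add
          ((hline hf p hp).const_mul ((p.2 : ℂ) ^ (n + 1)))
        have hU' : ∀ᶠ s : ℝ in 𝓝 p.1, (s, p.2) ∈ U :=
          (by fun_prop : ContinuousAt (fun s : ℝ => (s, p.2)) p.1).eventually (hU.mem_nhds hp)
        have hEq := hL.congr_of_eventuallyEq (f₁ := _) (hU'.mono fun s hs => (h _ hs).symm)
        have := hEq.unique hR
        push_cast [Nat.add_sub_cancel, Pi.pow_apply] at this
        linear_combination this)
    have hk : (k + 1 : ℂ) ≠ 0 := by exact_mod_cast Nat.succ_ne_zero k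
    simpa [hk] using this

/-- The quotient of two smooth homogeneous functions on `ℂ²`, the denominator vanishing at most at
the origin, is of class `C^n` if its degree is at least `n + 1`. -/
theorem contDiff_div_of_homogeneous {n k d : ℕ} (hk : n + 1 ≤ k) {f g : ℂ × ℂ → ℂ}
    (hf : ContDiff ℝ ∞ f) (hg : ContDiff ℝ ∞ g) (hg0 : ∀ w, w ≠ 0 → g w ≠ 0)
    (hfh : ∀ (t : ℝ) (w : ℂ × ℂ), f (t • w) = (t : ℂ) ^ (k + d) * f w)
    (hgh : ∀ (t : ℝ) (w : ℂ × ℂ), g (t • w) = (t : ℂ) ^ d * g w) :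
    ContDiff ℝ n (fun w => f w / g w) := by
  refine contDiff_of_homogeneous n k hk _ ?_ ?_
  · simp only [div_eq_mul_inv]
    exact hf.contDiffOn.mul (hg.contDiffOn.inv fun w hw => hg0 w hw)
  · intro t ht w
    have htd : (t : ℂ) ^ d ≠ 0 := by simp [ht.ne']
    rw [hfh, hgh, Complex.real_smul, Complex.ofReal_pow, pow_add, mul_comm ((t : ℂ) ^ k), mul_assoc,
      mul_div_mul_left _ _ htd, mul_div_assoc]

/-- The line bundle of left eigenvectors for the eigenvalue `1` of the matrices
`!![cos θ, sin θ * exp (iφ); sin θ * exp (-iφ), -cos θ]` over the two-sphere has no nowhere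
vanishing continuous section. -/
theorem no_nonvanishing_section (r₀ r₁ : (Fin 3 → ℂ) → ℂ) (σ : ℝ × ℝ → Fin 3 → ℂ)
    (hσ : ∀ x, σ x = ![Complex.cos x.1, Complex.sin x.1 * Complex.exp (x.2 * Complex.I),
      Complex.sin x.1 * Complex.exp (-(x.2 * Complex.I))])
    (h₀ : Continuous (r₀ ∘ σ)) (h₁ : Continuous (r₁ ∘ σ))
    (hne : ∀ x, ¬ (r₀ (σ x) = 0 ∧ r₁ (σ x) = 0))
    (he₀ : ∀ x, r₀ (σ x) * σ x 0 + r₁ (σ x) * σ x 2 = r₀ (σ x))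
    (he₁ : ∀ x, r₀ (σ x) * σ x 1 - r₁ (σ x) * σ x 0 = r₁ (σ x)) : False := by
  refine not_homotopy_const_winding (fun x => r₀ (σ x) * Complex.cos (x.1 / 2) +
    r₁ (σ x) * Complex.sin (x.1 / 2) * Complex.exp (-(x.2 * Complex.I))) ?_ ?_ ?_ ?_ ?_
  · have hcos : Continuous fun x : ℝ × ℝ => Complex.cos (x.1 / 2) := by fun_prop
    have hsin : Continuous fun x : ℝ × ℝ => Complex.sin (x.1 / 2) := by fun_prop
    have hexp : Continuous fun x : ℝ × ℝ => Complex.exp (-(x.2 * Complex.I)) := by fun_prop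
    exact (h₀.mul hcos).add ((h₁.mul hsin).mul hexp)
  · intro x hx
    refine hne x ?_
    have e₀ := he₀ x
    have e₁ := he₁ x
    generalize r₀ (σ x) = a at *
    generalize r₁ (σ x) = b at *
    have hs := Complex.sin_sq_add_cos_sq ((x.1 : ℂ) / 2)
    have hee : Complex.exp (x.2 * Complex.I) * Complex.exp (-(x.2 * Complex.I)) = 1 := by
      rw [← Complex.exp_add]; simp
    have hdouble : (x.1 : ℂ) = 2 * (x.1 / 2) := by ring
    simp only [hσ, Matrix.cons_val] at e₀ e₁
    rw [hdouble, Complex.sin_two_mul, Complex.cos_two_mul] at e₀ e₁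
    set c := Complex.cos ((x.1 : ℂ) / 2)
    set s := Complex.sin ((x.1 : ℂ) / 2)
    set u := Complex.exp (x.2 * Complex.I)
    set v := Complex.exp (-(x.2 * Complex.I))
    have hv : v ≠ 0 := Complex.exp_ne_zero _
    have key : a * s = b * c * v := by
      by_cases h : s = 0
      · have hc : c ≠ 0 := by rintro h'; simp [h, h'] at hs
        apply mul_left_cancel₀ hc
        linear_combination v / 2 * e₁ - a * s * c * hee
      · apply mul_left_cancel₀ h
        linear_combination a * hs - e₀ / 2
    have ha : a = 0 := by linear_combination c * hx + s * key - a * hs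
    have hb : b * v = 0 := by linear_combination s * hx - c * key - b * v * hs
    exact ⟨ha, (mul_eq_zero.1 hb).resolve_right hv⟩
  · intro θ
    have h1 : Complex.exp (2 * Real.pi * Complex.I) = 1 := Complex.exp_two_pi_mul_I
    have h2 : Complex.exp (-(2 * Real.pi * Complex.I)) = 1 := by rw [Complex.exp_neg, h1, inv_one]
    have : σ (θ, 2 * Real.pi) = σ (θ, 0) := by simp [hσ, h1, h2]
    simp [this, h2]
  · intro φ
    have : σ (0, φ) = σ (0, 0) := by simp [hσ]
    simp [this]
  · intro φ
    have : σ (Real.pi, φ) = σ (Real.pi, 0) := by simp [hσ]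
    have h2 : (Real.pi : ℂ) / 2 = ((Real.pi / 2 : ℝ) : ℂ) := by push_cast; ring
    simp [this]

section Algebra

open Matrix
open scoped Kronecker

/-- The block matrix acting as `φ₁` on the kernel and as `φ₂` on the range of the idempotent `Q`. -/
def twist (φ₁ φ₂ Q : Matrix (Fin 2) (Fin 2) ℂ) : Matrix (Fin 2 × Fin 2) (Fin 2 × Fin 2) ℂ :=
  φ₁ ⊗ₖ (1 - Q) + φ₂ ⊗ₖ Q

theorem twist_mul_twist {Q : Matrix (Fin 2) (Fin 2) ℂ} (hQ : Q * Q = Q)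
    (A B C D : Matrix (Fin 2) (Fin 2) ℂ) :
    twist A B Q * twist C D Q = twist (A * C) (B * D) Q := by
  have h1 : Q * (1 - Q) = 0 := by rw [mul_sub, mul_one, hQ, sub_self]
  have h2 : (1 - Q) * Q = 0 := by rw [sub_mul, one_mul, hQ, sub_self]
  have h3 : (1 - Q) * (1 - Q) = 1 - Q := by rw [mul_sub, h2, mul_one, sub_zero]
  simp only [twist, add_mul, mul_add, ← mul_kronecker_mul, h1, h2, h3, hQ, kronecker_zero,
    add_zero, zero_add]

theorem twist_self (A Q R : Matrix (Fin 2) (Fin 2) ℂ) : twist A A Q = twist A A R := by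
  simp only [twist, ← kronecker_add, sub_add_cancel]

theorem isUnit_twist {Q : Matrix (Fin 2) (Fin 2) ℂ} (hQ : Q * Q = Q)
    {A B : Matrix (Fin 2) (Fin 2) ℂ} (hA : IsUnit A) (hB : IsUnit B) : IsUnit (twist A B Q) := by
  obtain ⟨u, rfl⟩ := hA
  obtain ⟨v, rfl⟩ := hB
  have h1 : twist (1 : Matrix (Fin 2) (Fin 2) ℂ) 1 Q = 1 := by
    simp only [twist, ← kronecker_add, sub_add_cancel, one_kronecker_one]
  refine ⟨⟨twist u v Q, twist ↑u⁻¹ ↑v⁻¹ Q, ?_, ?_⟩, rfl⟩ <;>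
    simp [twist_mul_twist hQ, h1]

theorem twist_mul_one_kronecker (A B : Matrix (Fin 2) (Fin 2) ℂ) {E Q h : Matrix (Fin 2) (Fin 2) ℂ}
    (hh : E * h = h * Q) :
    twist A B E * ((1 : Matrix (Fin 2) (Fin 2) ℂ) ⊗ₖ h) =
      ((1 : Matrix (Fin 2) (Fin 2) ℂ) ⊗ₖ h) * twist A B Q := by
  simp only [twist, add_mul, mul_add, ← mul_kronecker_mul, mul_one, one_mul, sub_mul, mul_sub, hh]

theorem twist_similar {φ₁ φ₂ S R E Q : Matrix (Fin 2) (Fin 2) ℂ} (hE : E * E = E) (hQ : Q * Q = Q)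
    (hS : φ₁ * S = S * φ₂) (hR : φ₂ * R = R * φ₁) :
    twist φ₁ φ₂ E * (twist 1 R E * twist 1 S Q) =
      twist 1 R E * twist 1 S Q * twist φ₁ φ₂ Q := by
  rw [← mul_assoc, twist_mul_twist hE, mul_one, hR, mul_assoc, twist_mul_twist hQ, one_mul, ← hS]
  have h1 := twist_mul_twist hE 1 R φ₁ φ₁
  have h2 := twist_mul_twist hQ φ₁ φ₁ 1 S
  rw [one_mul] at h1
  rw [mul_one] at h2
  rw [← h1, ← h2, twist_self φ₁ E Q, mul_assoc]

theorem eq_inv_mul_mul_iff {n : Type*} [Fintype n] [DecidableEq n] {A B H : Matrix n n ℂ}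
    (hH : IsUnit H) : B = H⁻¹ * A * H ↔ A * H = H * B := by
  have hd := (isUnit_iff_isUnit_det H).1 hH
  constructor
  · rintro rfl
    rw [← mul_assoc, ← mul_assoc, mul_nonsing_inv _ hd, one_mul]
  · intro h
    rw [mul_assoc, h, ← mul_assoc, nonsing_inv_mul _ hd, one_mul]

end Algebra

section Local

open Matrix
open scoped ComplexConjugate

/-- The matrix family `!![0, x; y, 0]` with `x = w₁ ^ (ℓ + 3)` and `y = w₂ ^ (ℓ + 3)`. -/
def phiOne (ℓ : ℕ) (w : ℂ × ℂ) : Matrix (Fin 2) (Fin 2) ℂ :=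
  !![0, w.1 ^ (ℓ + 3); w.2 ^ (ℓ + 3), 0]

/-- The matrix family `!![g, x; y - g² / x, -g]` with `x = w₁ ^ (ℓ + 3)`, `y = w₂ ^ (ℓ + 3)` and
`g = (w₁ w₂) ^ (ℓ + 2)`. -/
def phiTwo (ℓ : ℕ) (w : ℂ × ℂ) : Matrix (Fin 2) (Fin 2) ℂ :=
  !![w.1 ^ (ℓ + 2) * w.2 ^ (ℓ + 2), w.1 ^ (ℓ + 3);
    w.2 ^ (ℓ + 3) - w.1 ^ (ℓ + 1) * w.2 ^ (2 * ℓ + 4), -(w.1 ^ (ℓ + 2) * w.2 ^ (ℓ + 2))]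

/-- The denominator `|w₁| ^ (2ℓ + 6) + |w₂| ^ (2ℓ + 6)`. -/
noncomputable def den (ℓ : ℕ) (w : ℂ × ℂ) : ℂ :=
  w.1 ^ (ℓ + 3) * conj w.1 ^ (ℓ + 3) + w.2 ^ (ℓ + 3) * conj w.2 ^ (ℓ + 3)

/-- A matrix function of class `C^ℓ` intertwining `phiOne` and `phiTwo`. -/
noncomputable def intertwiner (ℓ : ℕ) (w : ℂ × ℂ) : Matrix (Fin 2) (Fin 2) ℂ :=
  !![1 - w.1 ^ (ℓ + 1) * w.2 ^ (2 * ℓ + 4) * conj w.2 ^ (ℓ + 3) / den ℓ w,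
    -(w.1 ^ (ℓ + 2) * w.2 ^ (ℓ + 2) * conj w.2 ^ (ℓ + 3) / den ℓ w);
    w.1 ^ (ℓ + 2) * w.2 ^ (ℓ + 2) * conj w.1 ^ (ℓ + 3) / den ℓ w, 1]

theorem den_eq (ℓ : ℕ) (w : ℂ × ℂ) :
    den ℓ w = ((Complex.normSq w.1 ^ (ℓ + 3) + Complex.normSq w.2 ^ (ℓ + 3) : ℝ) : ℂ) := by
  simp [den, ← mul_pow, Complex.mul_conj]

theorem den_ne_zero (ℓ : ℕ) {w : ℂ × ℂ} (hw : w ≠ 0) : den ℓ w ≠ 0 := by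
  rw [den_eq, Complex.ofReal_ne_zero]
  intro h
  rw [add_eq_zero_iff_of_nonneg (by have := Complex.normSq_nonneg w.1; positivity)
    (by have := Complex.normSq_nonneg w.2; positivity)] at h
  simp at h
  exact hw (Prod.ext h.1 h.2)

theorem phiOne_mul_intertwiner (ℓ : ℕ) (w : ℂ × ℂ) :
    phiOne ℓ w * intertwiner ℓ w = intertwiner ℓ w * phiTwo ℓ w := by
  by_cases hw : w = 0
  · subst hw
    ext i j; fin_cases i <;> fin_cases j <;> simp [phiOne, phiTwo, intertwiner]
  · have hN := den_ne_zero ℓ hw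
    have hN' : den ℓ w = w.1 ^ (ℓ + 3) * conj w.1 ^ (ℓ + 3) +
      w.2 ^ (ℓ + 3) * conj w.2 ^ (ℓ + 3) := rfl
    ext i j
    fin_cases i <;> fin_cases j <;>
      simp [phiOne, phiTwo, intertwiner, Matrix.mul_apply, Fin.sum_univ_two] <;> field_simp <;>
      rw [hN'] <;> ring

theorem contDiff_intertwiner (ℓ : ℕ) (i j : Fin 2) :
    ContDiff ℝ ℓ (fun w => intertwiner ℓ w i j) := by
  have c1 : ContDiff ℝ ∞ fun w : ℂ × ℂ => conj w.1 :=
    Complex.conjCLE.contDiff.comp contDiff_fst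
  have c2 : ContDiff ℝ ∞ fun w : ℂ × ℂ => conj w.2 :=
    Complex.conjCLE.contDiff.comp contDiff_snd
  have hd : ContDiff ℝ ∞ (den ℓ) := by unfold den; fun_prop
  have hdh : ∀ (t : ℝ) (w : ℂ × ℂ), den ℓ (t • w) = (t : ℂ) ^ (2 * ℓ + 6) * den ℓ w := by
    intro t w
    simp only [den, Prod.smul_fst, Prod.smul_snd, Complex.real_smul, map_mul, Complex.conj_ofReal]
    ring
  fin_cases i <;> fin_cases j
  · exact contDiff_const.sub (contDiff_div_of_homogeneous (k := 2 * ℓ + 2) (d := 2 * ℓ + 6)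
      (by omega) (by fun_prop) hd (fun w hw => den_ne_zero ℓ hw) (fun t w => by
        simp only [Prod.smul_fst, Prod.smul_snd, Complex.real_smul, map_mul, Complex.conj_ofReal]
        ring) hdh)
  · exact (contDiff_div_of_homogeneous (k := ℓ + 1) (d := 2 * ℓ + 6)
      (by omega) (by fun_prop) hd (fun w hw => den_ne_zero ℓ hw) (fun t w => by
        simp only [Prod.smul_fst, Prod.smul_snd, Complex.real_smul, map_mul, Complex.conj_ofReal]
        ring) hdh).neg
  · exact contDiff_div_of_homogeneous (k := ℓ + 1) (d := 2 * ℓ + 6)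
      (by omega) (by fun_prop) hd (fun w hw => den_ne_zero ℓ hw) (fun t w => by
        simp only [Prod.smul_fst, Prod.smul_snd, Complex.real_smul, map_mul, Complex.conj_ofReal]
        ring) hdh
  · exact contDiff_const

theorem isUnit_intertwiner (ℓ : ℕ) {w : ℂ × ℂ} (h1 : ‖w.1‖ < 1) (h2 : ‖w.2‖ < 1) :
    IsUnit (intertwiner ℓ w) := by
  rw [isUnit_iff_isUnit_det, isUnit_iff_ne_zero]
  by_cases hw : w = 0
  · subst hw; simp [intertwiner, det_fin_two]
  have hN := den_ne_zero ℓ hw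
  have hN' : den ℓ w = w.1 ^ (ℓ + 3) * conj w.1 ^ (ℓ + 3) +
      w.2 ^ (ℓ + 3) * conj w.2 ^ (ℓ + 3) := rfl
  intro h
  have h3 : den ℓ w ^ 2 = w.1 ^ (ℓ + 1) * w.2 ^ (3 * ℓ + 7) * conj w.2 ^ (2 * ℓ + 6) := by
    rw [det_fin_two] at h
    simp [intertwiner] at h
    field_simp at h
    have h5 : (w.1 ^ (ℓ + 1) * w.2 ^ (2 * ℓ + 4) * conj w.2 ^ (ℓ + 3)) * den ℓ w =
      (w.1 ^ (ℓ + 1) * w.2 ^ (2 * ℓ + 4) * conj w.2 ^ (ℓ + 3)) *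
      (w.1 ^ (ℓ + 3) * conj w.1 ^ (ℓ + 3) + w.2 ^ (ℓ + 3) * conj w.2 ^ (ℓ + 3)) := by rw [hN']
    linear_combination h + h5
  have h4 := congrArg norm h3
  rw [den_eq, norm_pow, Complex.norm_real, Real.norm_of_nonneg (by
    have := Complex.normSq_nonneg w.1; have := Complex.normSq_nonneg w.2; positivity)] at h4
  simp only [norm_mul, norm_pow, RCLike.norm_conj, Complex.normSq_eq_norm_sq] at h4
  have hd : (‖w.1‖ ^ 2) ^ (ℓ + 3) + (‖w.2‖ ^ 2) ^ (ℓ + 3) ≠ 0 := by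
    rw [den_eq, Complex.ofReal_ne_zero] at hN
    simpa only [Complex.normSq_eq_norm_sq] using hN
  have ha := norm_nonneg w.1
  have hb := norm_nonneg w.2
  generalize ‖w.1‖ = a at *
  generalize ‖w.2‖ = b at *
  have hab : (a * b) ^ (ℓ + 1) < 1 :=
    pow_lt_one₀ (mul_nonneg ha hb) (mul_lt_one_of_nonneg_of_lt_one_left ha h1 h2.le) (by omega)
  have hA : 0 ≤ (a ^ 2) ^ (ℓ + 3) := by positivity
  have hB : 0 ≤ (b ^ 2) ^ (ℓ + 3) := by positivity
  have h5 : ((a ^ 2) ^ (ℓ + 3) + (b ^ 2) ^ (ℓ + 3)) ^ 2 =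
      (a * b) ^ (ℓ + 1) * ((b ^ 2) ^ (ℓ + 3)) ^ 2 := by rw [h4]; ring
  generalize (a ^ 2) ^ (ℓ + 3) = A at *
  generalize (b ^ 2) ^ (ℓ + 3) = B at *
  rcases hB.eq_or_lt with rfl | hB'
  · apply hd
    simpa using h5
  · nlinarith [mul_pos hB' hB', mul_nonneg hA hB]

end Local

section Global

open Matrix
open scoped Kronecker

/-- The quadratic form `z₀² + z₁ z₂` on `ℂ³`. -/
def quad (z : Fin 3 → ℂ) : ℂ := z 0 ^ 2 + z 1 * z 2

/-- For `z` with `quad z ≠ 0`, the projector onto an eigenline of `!![z₀, z₁; z₂, -z₀]`. -/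
noncomputable def proj (z : Fin 3 → ℂ) : Matrix (Fin 2) (Fin 2) ℂ :=
  !![(1 + z 0 * (quad z ^ (2⁻¹ : ℂ))⁻¹) / 2, z 1 * (quad z ^ (2⁻¹ : ℂ))⁻¹ / 2;
    z 2 * (quad z ^ (2⁻¹ : ℂ))⁻¹ / 2, (1 - z 0 * (quad z ^ (2⁻¹ : ℂ))⁻¹) / 2]

/-- The constant rank one projector `diag (1, 0)`. -/
def constProj : Matrix (Fin 2) (Fin 2) ℂ := !![1, 0; 0, 0]

theorem constProj_mul_self : constProj * constProj = constProj := by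
  ext i j; fin_cases i <;> fin_cases j <;> simp [constProj]

theorem proj_trace (z : Fin 3 → ℂ) : proj z 0 0 + proj z 1 1 = 1 := by
  simp [proj]; ring

theorem proj_det {z : Fin 3 → ℂ} (hz : quad z ≠ 0) :
    proj z 0 0 * proj z 1 1 = proj z 0 1 * proj z 1 0 := by
  have h : (quad z ^ (2⁻¹ : ℂ)) ^ 2 = quad z := by
    simp
  have h0 : quad z ^ (2⁻¹ : ℂ) ≠ 0 := by
    intro h0; rw [h0] at h; exact hz (by simpa using h.symm)
  have h1 : z 0 ^ 2 + z 1 * z 2 = (quad z ^ (2⁻¹ : ℂ)) ^ 2 := h.symm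
  simp only [proj, Matrix.of_apply, Matrix.cons_val]
  generalize quad z ^ (2⁻¹ : ℂ) = s at *
  field_simp
  linear_combination -h1

theorem proj_mul_self {z : Fin 3 → ℂ} (hz : quad z ≠ 0) : proj z * proj z = proj z := by
  have h1 := proj_trace z
  have h2 := proj_det hz
  ext i j
  fin_cases i <;> fin_cases j <;> simp only [Matrix.mul_apply, Fin.sum_univ_two] <;> simp
  · linear_combination proj z 0 0 * h1 - h2
  · linear_combination proj z 0 1 * h1
  · linear_combination proj z 1 0 * h1
  · linear_combination proj z 1 1 * h1 - h2

theorem contDiffOn_proj (n : WithTop ℕ∞) (i j : Fin 2) :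
    ContDiffOn ℂ n (fun z => proj z i j) {z | quad z ∈ Complex.slitPlane} := by
  have hq : ContDiff ℂ n quad := by unfold quad; fun_prop
  have h1 : ContDiffOn ℂ n (fun u : ℂ => (u ^ (2⁻¹ : ℂ))⁻¹) Complex.slitPlane := by
    refine DifferentiableOn.contDiffOn (fun u hu => DifferentiableAt.differentiableWithinAt ?_)
      Complex.isOpen_slitPlane
    refine (differentiableAt_id.cpow_const hu).inv ?_
    simp [Complex.cpow_eq_zero_iff, Complex.slitPlane_ne_zero hu]
  have h2 : ContDiffOn ℂ n (fun z => (quad z ^ (2⁻¹ : ℂ))⁻¹) {z | quad z ∈ Complex.slitPlane} :=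
    h1.comp hq.contDiffOn fun z hz => hz
  fin_cases i <;> fin_cases j <;> simp only [proj, Matrix.of_apply] <;> simp <;>
    fun_prop

/-- The ambient open set: the product of a conical neighbourhood of the two-sphere with the
bidisc. -/
def ambient : Set ((Fin 3 → ℂ) × (ℂ × ℂ)) :=
  {ζ | quad ζ.1 ∈ Complex.slitPlane ∧ ‖ζ.2.1‖ < 1 ∧ ‖ζ.2.2‖ < 1}

theorem isOpen_ambient : IsOpen ambient := by
  have hq : Continuous fun ζ : (Fin 3 → ℂ) × (ℂ × ℂ) => quad ζ.1 := by unfold quad; fun_prop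
  exact (Complex.isOpen_slitPlane.preimage hq).inter
    ((isOpen_lt (f := fun ζ : (Fin 3 → ℂ) × (ℂ × ℂ) => ‖ζ.2.1‖) (by fun_prop)
      continuous_const).inter
      (isOpen_lt (f := fun ζ : (Fin 3 → ℂ) × (ℂ × ℂ) => ‖ζ.2.2‖) (by fun_prop) continuous_const))

/-- Spherical coordinates on the two-sphere. -/
noncomputable def sphere (x : ℝ × ℝ) : Fin 3 → ℂ :=
  ![Complex.cos x.1, Complex.sin x.1 * Complex.exp (x.2 * Complex.I),
      Complex.sin x.1 * Complex.exp (-(x.2 * Complex.I))]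

theorem quad_sphere (x : ℝ × ℝ) : quad (sphere x) = 1 := by
  have hee : Complex.exp (x.2 * Complex.I) * Complex.exp (-(x.2 * Complex.I)) = 1 := by
    rw [← Complex.exp_add]; simp
  simp only [quad, sphere, Matrix.cons_val]
  linear_combination Complex.sin_sq_add_cos_sq (x.1 : ℂ) + Complex.sin x.1 ^ 2 * hee

theorem continuous_sphere : Continuous sphere := by
  refine continuous_pi fun i => ?_
  fin_cases i <;> simp only [sphere] <;> simp <;> fun_prop

/-- The connected component of the two-sphere in `ambient`. -/
noncomputable def domain : Set ((Fin 3 → ℂ) × (ℂ × ℂ)) :=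
  connectedComponentIn ambient (sphere (0, 0), 0)

theorem sphere_mem_ambient (x : ℝ × ℝ) : (sphere x, (0 : ℂ × ℂ)) ∈ ambient := by
  simp [ambient, quad_sphere]

theorem sphere_mem_domain (x : ℝ × ℝ) : (sphere x, (0 : ℂ × ℂ)) ∈ domain := by
  have h : IsPreconnected (Set.range fun x : ℝ × ℝ => (sphere x, (0 : ℂ × ℂ))) :=
    isPreconnected_range (continuous_sphere.prodMk continuous_const)
  exact h.subset_connectedComponentIn (mem_range_self (0, 0))
    (by rintro _ ⟨y, rfl⟩; exact sphere_mem_ambient y) (mem_range_self x)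

theorem isOpen_domain : IsOpen domain := isOpen_ambient.connectedComponentIn

theorem isConnected_domain : IsConnected domain :=
  isConnected_connectedComponentIn_iff.2 (sphere_mem_ambient _)

theorem domain_subset : domain ⊆ ambient := connectedComponentIn_subset _ _

theorem contDiffOn_proj_domain (n : WithTop ℕ∞) (i j : Fin 2) :
    ContDiffOn ℂ n (fun ζ : (Fin 3 → ℂ) × (ℂ × ℂ) => proj ζ.1 i j) domain :=
  (contDiffOn_proj n i j).comp contDiff_fst.contDiffOn fun _ hζ => (domain_subset hζ).1

theorem quad_ne_zero {ζ : (Fin 3 → ℂ) × (ℂ × ℂ)} (hζ : ζ ∈ domain) : quad ζ.1 ≠ 0 :=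
  Complex.slitPlane_ne_zero (domain_subset hζ).1

theorem differentiable_phiOne (ℓ : ℕ) (i j : Fin 2) :
    Differentiable ℂ fun ζ : (Fin 3 → ℂ) × (ℂ × ℂ) => phiOne ℓ ζ.2 i j := by
  fin_cases i <;> fin_cases j <;> simp only [phiOne] <;> simp <;> fun_prop

theorem differentiable_phiTwo (ℓ : ℕ) (i j : Fin 2) :
    Differentiable ℂ fun ζ : (Fin 3 → ℂ) × (ℂ × ℂ) => phiTwo ℓ ζ.2 i j := by
  fin_cases i <;> fin_cases j <;> simp only [phiTwo] <;> simp <;> fun_prop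

/-- Near each point, a rank one projector is holomorphically conjugate to `constProj`. -/
theorem exists_local_conjugation {ξ : (Fin 3 → ℂ) × (ℂ × ℂ)} (hξ : ξ ∈ domain) :
    ∃ U : Set ((Fin 3 → ℂ) × (ℂ × ℂ)), IsOpen U ∧ ξ ∈ U ∧ U ⊆ domain ∧
      ∃ h : (Fin 3 → ℂ) × (ℂ × ℂ) → Matrix (Fin 2) (Fin 2) ℂ,
        (∀ i j, DifferentiableOn ℂ (fun ζ => h ζ i j) U) ∧
        ∀ ζ ∈ U, IsUnit (h ζ) ∧ constProj * h ζ = h ζ * proj ζ.1 := by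
  have hP : ∀ i j, DifferentiableOn ℂ (fun ζ : (Fin 3 → ℂ) × (ℂ × ℂ) => proj ζ.1 i j) domain :=
    fun i j => (contDiffOn_proj_domain 1 i j).differentiableOn one_ne_zero
  have hopen : ∀ i, IsOpen (domain ∩
      (fun ζ : (Fin 3 → ℂ) × (ℂ × ℂ) => proj ζ.1 i i) ⁻¹' {0}ᶜ) := fun i =>
    (hP i i).continuousOn.isOpen_inter_preimage isOpen_domain isOpen_compl_singleton
  by_cases h00 : proj ξ.1 0 0 = 0
  · refine ⟨_, hopen 1, ⟨hξ, ?_⟩, inter_subset_left,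
      fun ζ => !![proj ζ.1 1 0, proj ζ.1 1 1; proj ζ.1 1 1, -proj ζ.1 0 1], ?_, ?_⟩
    · have := proj_trace ξ.1
      rw [h00, zero_add] at this
      simp [this]
    · intro i j
      have h10 := (hP 1 0).mono (inter_subset_left (t := (fun ζ : (Fin 3 → ℂ) × (ℂ × ℂ) =>
        proj ζ.1 1 1) ⁻¹' {0}ᶜ))
      have h11 := (hP 1 1).mono (inter_subset_left (t := (fun ζ : (Fin 3 → ℂ) × (ℂ × ℂ) =>
        proj ζ.1 1 1) ⁻¹' {0}ᶜ))
      have h01 := (hP 0 1).mono (inter_subset_left (t := (fun ζ : (Fin 3 → ℂ) × (ℂ × ℂ) =>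
        proj ζ.1 1 1) ⁻¹' {0}ᶜ))
      fin_cases i <;> fin_cases j
      exacts [h10, h11, h11, h01.neg]
    · rintro ζ ⟨hζ, hne⟩
      have ht := proj_trace ζ.1
      have hd := proj_det (quad_ne_zero hζ)
      constructor
      · rw [isUnit_iff_isUnit_det, isUnit_iff_ne_zero, det_fin_two]
        simp only [Matrix.of_apply, Matrix.cons_val]
        intro h
        apply hne
        change proj ζ.1 1 1 = 0
        simp at h
        linear_combination -h + (-proj ζ.1 1 1) * ht + hd
      · ext i j
        fin_cases i <;> fin_cases j <;> simp [constProj, Matrix.mul_apply, Fin.sum_univ_two]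
        · linear_combination -proj ζ.1 1 0 * ht
        · linear_combination -proj ζ.1 1 1 * ht + hd
        · linear_combination -hd
        · ring
  · refine ⟨_, hopen 0, ⟨hξ, h00⟩, inter_subset_left,
      fun ζ => !![proj ζ.1 0 0, proj ζ.1 0 1; -proj ζ.1 1 0, proj ζ.1 0 0], ?_, ?_⟩
    · intro i j
      have h10 := (hP 1 0).mono (inter_subset_left (t := (fun ζ : (Fin 3 → ℂ) × (ℂ × ℂ) =>
        proj ζ.1 0 0) ⁻¹' {0}ᶜ))
      have h00 := (hP 0 0).mono (inter_subset_left (t := (fun ζ : (Fin 3 → ℂ) × (ℂ × ℂ) =>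
        proj ζ.1 0 0) ⁻¹' {0}ᶜ))
      have h01 := (hP 0 1).mono (inter_subset_left (t := (fun ζ : (Fin 3 → ℂ) × (ℂ × ℂ) =>
        proj ζ.1 0 0) ⁻¹' {0}ᶜ))
      fin_cases i <;> fin_cases j
      exacts [h00, h01, h10.neg, h00]
    · rintro ζ ⟨hζ, hne⟩
      have ht := proj_trace ζ.1
      have hd := proj_det (quad_ne_zero hζ)
      constructor
      · rw [isUnit_iff_isUnit_det, isUnit_iff_ne_zero, det_fin_two]
        simp only [Matrix.of_apply, Matrix.cons_val]
        intro h
        apply hne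
        change proj ζ.1 0 0 = 0
        simp at h
        linear_combination h - proj ζ.1 0 0 * ht + hd
      · ext i j
        fin_cases i <;> fin_cases j <;> simp [constProj, Matrix.mul_apply, Fin.sum_univ_two]
        · linear_combination -proj ζ.1 0 0 * ht + hd
        · linear_combination -proj ζ.1 0 1 * ht
        · ring
        · linear_combination -hd

/-- Reindexing of `4 × 4` matrices as `2 × 2` block matrices. -/
def blocks : Matrix (Fin 2 × Fin 2) (Fin 2 × Fin 2) ℂ ≃ₐ[ℂ] Matrix (Fin 4) (Fin 4) ℂ :=
  reindexAlgEquiv ℂ ℂ (finProdFinEquiv (m := 2) (n := 2))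

theorem blocks_apply (M : Matrix (Fin 2 × Fin 2) (Fin 2 × Fin 2) ℂ) (i j : Fin 4) :
    blocks M i j = M ((finProdFinEquiv (m := 2) (n := 2)).symm i)
      ((finProdFinEquiv (m := 2) (n := 2)).symm j) := rfl

theorem blocks_symm_apply (M : Matrix (Fin 4) (Fin 4) ℂ) (a b : Fin 2 × Fin 2) :
    blocks.symm M a b = M (finProdFinEquiv (m := 2) (n := 2) a)
      (finProdFinEquiv (m := 2) (n := 2) b) := rfl

theorem differentiableOn_twist {ℓ : ℕ} {Q : (Fin 3 → ℂ) × (ℂ × ℂ) → Matrix (Fin 2) (Fin 2) ℂ}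
    (hQ : ∀ i j, DifferentiableOn ℂ (fun ζ => Q ζ i j) domain) (i j : Fin 4) :
    DifferentiableOn ℂ (fun ζ => blocks (twist (phiOne ℓ ζ.2) (phiTwo ℓ ζ.2) (Q ζ)) i j)
      domain := by
  simp only [blocks_apply, twist, Matrix.add_apply, kroneckerMap_apply, Matrix.sub_apply]
  exact ((differentiable_phiOne ℓ _ _).differentiableOn.mul
    ((differentiableOn_const _).sub (hQ _ _))).add
    ((differentiable_phiTwo ℓ _ _).differentiableOn.mul (hQ _ _))

theorem contDiffOn_twist {n : WithTop ℕ∞} {X : Set ((Fin 3 → ℂ) × (ℂ × ℂ))}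
    {A B Q : (Fin 3 → ℂ) × (ℂ × ℂ) → Matrix (Fin 2) (Fin 2) ℂ}
    (hA : ∀ i j, ContDiffOn ℝ n (fun ζ => A ζ i j) X)
    (hB : ∀ i j, ContDiffOn ℝ n (fun ζ => B ζ i j) X)
    (hQ : ∀ i j, ContDiffOn ℝ n (fun ζ => Q ζ i j) X) (a b : Fin 2 × Fin 2) :
    ContDiffOn ℝ n (fun ζ => twist (A ζ) (B ζ) (Q ζ) a b) X := by
  simp only [twist, Matrix.add_apply, kroneckerMap_apply, Matrix.sub_apply]
  exact ((hA _ _).mul (contDiffOn_const.sub (hQ _ _))).add ((hB _ _).mul (hQ _ _))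

/-- On the sphere, the top left corner of a smooth intertwiner gives a section of the line bundle
of left eigenvectors. -/
theorem corner_of_smooth_similarity {ℓ : ℕ}
    {T : (Fin 3 → ℂ) × (ℂ × ℂ) → Matrix (Fin 2 × Fin 2) (Fin 2 × Fin 2) ℂ}
    (hT : ∀ a b, ContDiffOn ℝ ∞ (fun ζ => T ζ a b) domain)
    (h : ∀ ζ ∈ domain, twist (phiOne ℓ ζ.2) (phiTwo ℓ ζ.2) constProj * T ζ =
      T ζ * twist (phiOne ℓ ζ.2) (phiTwo ℓ ζ.2) (proj ζ.1)) (x : ℝ × ℝ) (j : Fin 2) :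
    T (sphere x, 0) (0, 0) (1, j) = 0 ∧
      T (sphere x, 0) (0, 0) (0, 0) * proj (sphere x) 0 j +
        T (sphere x, 0) (0, 0) (0, 1) * proj (sphere x) 1 j = T (sphere x, 0) (0, 0) (0, j) := by
  set Q := proj (sphere x) with hQ
  have hι : ContDiff ℝ ∞ fun p : ℝ × ℝ => (sphere x, ((p.1 : ℂ), (p.2 : ℂ))) :=
    contDiff_const.prodMk ((Complex.ofRealCLM.contDiff.comp contDiff_fst).prodMk
      (Complex.ofRealCLM.contDiff.comp contDiff_snd))
  set U : Set (ℝ × ℝ) := (fun p : ℝ × ℝ => (sphere x, ((p.1 : ℂ), (p.2 : ℂ)))) ⁻¹' domain with hU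
  have hUo : IsOpen U := isOpen_domain.preimage hι.continuous
  have h0 : (0, 0) ∈ U := by
    change (sphere x, (((0 : ℝ) : ℂ), ((0 : ℝ) : ℂ))) ∈ domain
    rw [Complex.ofReal_zero]
    exact sphere_mem_domain x
  set t : Fin 2 × Fin 2 → Fin 2 × Fin 2 → ℝ × ℝ → ℂ :=
    fun a b p => T (sphere x, ((p.1 : ℂ), (p.2 : ℂ))) a b with ht
  have htU : ∀ a b, ContDiffOn ℝ ∞ (t a b) U := fun a b =>
    (hT a b).comp hι.contDiffOn fun p hp => hp
  have hrel : ∀ p ∈ U, ∀ j, (p.1 : ℂ) ^ (ℓ + 2 + 1) * t (1, 0) (0, j) p =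
      (p.1 : ℂ) ^ (ℓ + 2) * (p.2 : ℂ) ^ (ℓ + 2) *
        (t (0, 0) (0, 0) p * Q 0 j + t (0, 0) (0, 1) p * Q 1 j - t (0, 0) (0, j) p) +
      (p.2 : ℂ) ^ (ℓ + 2 + 1) * (t (0, 0) (1, j) p - (p.1 : ℂ) ^ (ℓ + 1) * (p.2 : ℂ) ^ (ℓ + 1) *
        (t (0, 0) (1, 0) p * Q 0 j + t (0, 0) (1, 1) p * Q 1 j)) := by
    intro p hp j
    have h1 := congrFun (congrFun (h _ hp) (0, 0)) (0, j)
    simp only [Matrix.mul_apply, Fintype.sum_prod_type, Fin.sum_univ_two, twist, Matrix.add_apply,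
      kroneckerMap_apply, Matrix.sub_apply, ← hQ] at h1
    simp only [ht]
    obtain rfl | rfl : j = 0 ∨ j = 1 := by omega
    all_goals
      simp [phiOne, phiTwo, constProj] at h1 ⊢
      linear_combination h1
  have hb : t (0, 0) (1, j) (0, 0) = 0 := by
    refine eq_zero_of_axis hUo h0 (htU _ _).continuousOn fun p hp h1 h2 => ?_
    have h3 := hrel p hp j
    simpa [h1, h2] using h3
  have hpow : ContDiff ℝ ∞ fun p : ℝ × ℝ => (p.1 : ℂ) ^ (ℓ + 1) * (p.2 : ℂ) ^ (ℓ + 1) :=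
    ((Complex.ofRealCLM.contDiff.comp contDiff_fst).pow _).mul
      ((Complex.ofRealCLM.contDiff.comp contDiff_snd).pow _)
  have he := smooth_obstruction (ℓ + 2) hUo h0 (ℓ + 2) _ _ _ (htU _ _)
    ((((htU _ _).mul contDiffOn_const).add ((htU _ _).mul contDiffOn_const)).sub (htU _ _))
    ((htU _ _).sub (hpow.contDiffOn.mul
      (((htU _ _).mul contDiffOn_const).add ((htU _ _).mul contDiffOn_const))))
    (fun p hp => hrel p hp j)
  simp only [ht, Complex.ofReal_zero] at hb he
  exact ⟨hb, sub_eq_zero.1 he⟩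

theorem not_smoothly_similar (ℓ : ℕ)
    (T : (Fin 3 → ℂ) × (ℂ × ℂ) → Matrix (Fin 2 × Fin 2) (Fin 2 × Fin 2) ℂ)
    (hT : ∀ a b, ContDiffOn ℝ ∞ (fun ζ => T ζ a b) domain) (hu : ∀ ζ ∈ domain, IsUnit (T ζ))
    (h : ∀ ζ ∈ domain, twist (phiOne ℓ ζ.2) (phiTwo ℓ ζ.2) constProj * T ζ =
      T ζ * twist (phiOne ℓ ζ.2) (phiTwo ℓ ζ.2) (proj ζ.1)) : False := by
  have hcorner := corner_of_smooth_similarity hT h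
  have hcont : ∀ a b, Continuous ((fun z => T (z, 0) a b) ∘ sphere) := fun a b =>
    (hT a b).continuousOn.comp_continuous (continuous_sphere.prodMk continuous_const)
      sphere_mem_domain
  refine no_nonvanishing_section (fun z => T (z, 0) (0, 0) (0, 0))
    (fun z => T (z, 0) (0, 0) (0, 1)) sphere (fun _ => rfl) (hcont _ _) (hcont _ _) ?_ ?_ ?_
  · rintro x ⟨h1, h2⟩
    have hdet := (isUnit_iff_isUnit_det _).1 (hu _ (sphere_mem_domain x))
    rw [isUnit_iff_ne_zero] at hdet
    refine hdet (det_eq_zero_of_row_eq_zero (0, 0) ?_)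
    rintro ⟨i, j⟩
    fin_cases i
    · fin_cases j
      exacts [h1, h2]
    · exact (hcorner x j).1
  · intro x
    have := (hcorner x 0).2
    simp [proj, quad_sphere] at this
    linear_combination 2 * this
  · intro x
    have := (hcorner x 1).2
    simp [proj, quad_sphere] at this
    linear_combination 2 * this

end Global

end SimilarityCounterexample

/-- For every `ℓ ∈ ℕ` there are a nonempty connected open set `X ⊆ ℂ³ × ℂ²` and holomorphic
maps `Φ, Ψ : X → Mat(4×4,ℂ)` which are locally holomorphically similar at every point of `X`
and globally `C^ℓ` similar on `X`, but not globally `C^∞` similar on `X`. -/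
theorem global_counterexample (ℓ : ℕ) :
    ∃ (X : Set ((Fin 3 → ℂ) × (ℂ × ℂ)))
      (Φ Ψ : ((Fin 3 → ℂ) × (ℂ × ℂ)) → Matrix (Fin 4) (Fin 4) ℂ),
      X.Nonempty ∧ IsOpen X ∧ IsConnected X ∧
      (∀ i j, DifferentiableOn ℂ (fun ζ => Φ ζ i j) X) ∧
      (∀ i j, DifferentiableOn ℂ (fun ζ => Ψ ζ i j) X) ∧
      -- (a) local holomorphic similarity at every point of X
      (∀ ξ ∈ X, ∃ U : Set ((Fin 3 → ℂ) × (ℂ × ℂ)), IsOpen U ∧ ξ ∈ U ∧ U ⊆ X ∧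
        ∃ H : ((Fin 3 → ℂ) × (ℂ × ℂ)) → Matrix (Fin 4) (Fin 4) ℂ,
          (∀ i j, DifferentiableOn ℂ (fun ζ => H ζ i j) U) ∧
          ∀ ζ ∈ U, IsUnit (H ζ) ∧ Ψ ζ = (H ζ)⁻¹ * Φ ζ * H ζ) ∧
      -- (b) global C^ℓ similarity on X
      (∃ T : ((Fin 3 → ℂ) × (ℂ × ℂ)) → Matrix (Fin 4) (Fin 4) ℂ,
        (∀ i j, ContDiffOn ℝ ℓ (fun ζ => T ζ i j) X) ∧
        ∀ ζ ∈ X, IsUnit (T ζ) ∧ Ψ ζ = (T ζ)⁻¹ * Φ ζ * T ζ) ∧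
      -- (c) no global C^∞ similarity on X
      ¬ (∃ T : ((Fin 3 → ℂ) × (ℂ × ℂ)) → Matrix (Fin 4) (Fin 4) ℂ,
        (∀ i j, ContDiffOn ℝ (⊤ : ℕ∞) (fun ζ => T ζ i j) X) ∧
        ∀ ζ ∈ X, IsUnit (T ζ) ∧ Ψ ζ = (T ζ)⁻¹ * Φ ζ * T ζ) := by
  open SimilarityCounterexample in
  have hQ : ∀ i j, DifferentiableOn ℂ
      (fun ζ : (Fin 3 → ℂ) × (ℂ × ℂ) => proj ζ.1 i j) domain :=
    fun i j => (contDiffOn_proj_domain 1 i j).differentiableOn one_ne_zero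
  refine ⟨domain, fun ζ => blocks (twist (phiOne ℓ ζ.2) (phiTwo ℓ ζ.2) constProj),
    fun ζ => blocks (twist (phiOne ℓ ζ.2) (phiTwo ℓ ζ.2) (proj ζ.1)),
    isConnected_domain.nonempty, isOpen_domain, isConnected_domain,
    differentiableOn_twist fun i j => differentiableOn_const _, differentiableOn_twist hQ,
    fun ξ hξ => ?_, ?_, ?_⟩
  · obtain ⟨U, hU, hξU, hUX, h, hh, hconj⟩ := exists_local_conjugation hξ
    refine ⟨U, hU, hξU, hUX,
      fun ζ => blocks (Matrix.kronecker (1 : Matrix (Fin 2) (Fin 2) ℂ) (h ζ)),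
      fun i j => ?_, fun ζ hζ => ?_⟩
    · simp only [blocks_apply, Matrix.kronecker, Matrix.kroneckerMap_apply]
      exact (differentiableOn_const _).mul (hh _ _)
    · obtain ⟨hu, hE⟩ := hconj ζ hζ
      have hunit : IsUnit (blocks (Matrix.kronecker (1 : Matrix (Fin 2) (Fin 2) ℂ) (h ζ))) :=
        (Matrix.IsUnit.kronecker isUnit_one hu).map blocks
      refine ⟨hunit, (eq_inv_mul_mul_iff hunit).2 ?_⟩
      rw [← map_mul, ← map_mul]
      exact congrArg blocks (twist_mul_one_kronecker _ _ hE)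
  · have hS : ∀ i j, ContDiffOn ℝ ℓ
        (fun ζ : (Fin 3 → ℂ) × (ℂ × ℂ) => intertwiner ℓ ζ.2 i j) domain := fun i j =>
      ((contDiff_intertwiner ℓ i j).comp contDiff_snd).contDiffOn
    have hR : ∀ i j, ContDiffOn ℝ ℓ
        (fun ζ : (Fin 3 → ℂ) × (ℂ × ℂ) => (intertwiner ℓ ζ.2).adjugate i j) domain := by
      intro i j
      simp only [Matrix.adjugate_fin_two]
      fin_cases i <;> fin_cases j
      exacts [hS 1 1, (hS 0 1).neg, (hS 1 0).neg, hS 0 0]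
    refine ⟨fun ζ => blocks (twist 1 (intertwiner ℓ ζ.2).adjugate constProj *
      twist 1 (intertwiner ℓ ζ.2) (proj ζ.1)), fun i j => ?_, fun ζ hζ => ?_⟩
    · simp only [blocks_apply, Matrix.mul_apply]
      exact ContDiffOn.sum fun a _ =>
        (contDiffOn_twist (fun i j => contDiffOn_const) hR (fun i j => contDiffOn_const) _ _).mul
          (contDiffOn_twist (fun i j => contDiffOn_const) hS
            (fun i j => (contDiffOn_proj_domain ℓ i j).restrict_scalars ℝ) _ _)
    · have hP := proj_mul_self (quad_ne_zero hζ)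
      have hSu := isUnit_intertwiner ℓ (domain_subset hζ).2.1 (domain_subset hζ).2.2
      have hRu : IsUnit (intertwiner ℓ ζ.2).adjugate := by
        rw [Matrix.isUnit_iff_isUnit_det] at hSu ⊢
        rw [Matrix.det_adjugate]
        exact hSu.pow _
      have hunit := ((isUnit_twist constProj_mul_self isUnit_one hRu).mul
        (isUnit_twist hP isUnit_one hSu)).map blocks
      refine ⟨hunit, (eq_inv_mul_mul_iff hunit).2 ?_⟩
      rw [← map_mul, ← map_mul]
      refine congrArg blocks (twist_similar constProj_mul_self hP (phiOne_mul_intertwiner ℓ ζ.2) ?_)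
      apply hSu.mul_left_cancel
      rw [← mul_assoc, ← phiOne_mul_intertwiner, mul_assoc, Matrix.mul_adjugate, ← mul_assoc,
        Matrix.mul_adjugate]
      simp
  · rintro ⟨T, hT, hconj⟩
    refine not_smoothly_similar ℓ (fun ζ => blocks.symm (T ζ))
      (fun a b => by simpa only [blocks_symm_apply] using hT _ _)
      (fun ζ hζ => (hconj ζ hζ).1.map blocks.symm) fun ζ hζ => ?_
    have h := (eq_inv_mul_mul_iff (hconj ζ hζ).1).1 (hconj ζ hζ).2
    apply blocks.injective
    simpa only [map_mul, AlgEquiv.apply_symm_apply] using h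
end
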